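/- Let Q be an integer with 3 ≤ Q ≤ 7, N = {x_0, x_1, x_2, …} a one-sided infinite geodesic ray in 𝔾^Q starting from a root 0 = x_0, and A_{ℍ^Q} := A_{𝔾^Q} + P_{ℓ²(N)}. Set λ* := (3−√5)Q/2 + √5 and a* := a(λ*), where a(λ) = λ(1 − √(1 − 4(Q−1)/λ²))/(2(Q−1)). Then the function v defined on the vertices of 𝔾^Q by v(x) := (a*)^{d(x,N)} · [ n(x)(1 − a*) + 1 ], where x_{n(x)} is the unique vertex of N closest to x, is a generalized Perron–Frobenius eigenvector of A_{ℍ^Q}: v has strictly positive entries and Σ_y (A_{ℍ^Q})_{xy} v(y) = λ* v(x) for every vertex x; in particular ‖A_{ℍ^Q}‖ = λ*. -/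

import Mathlib

open Filter MeasureTheory Set
open scoped Topology Classical ENNReal

noncomputable section

/-- The Hilbert space ℓ²(V) with complex coefficients. -/
abbrev L2 (V : Type) := lp (fun _ : V => ℂ) 2

/-- The coordinate (delta) vector at a vertex `x`. -/
def delta {V : Type} (x : V) : L2 V :=
  haveI := Classical.decEq V; lp.single 2 x 1

/-- The matrix entry `B_{x y} = (B δ_y)(x)` of a bounded operator on ℓ²(V). -/
def entry {V : Type} (B : L2 V →L[ℂ] L2 V) (x y : V) : ℂ :=
  (B (delta y) : ∀ _ : V, ℂ) x

/-- The resolvent `R_B(z) = (z·1 − B)⁻¹` (junk value if not invertible). -/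
def Res {V : Type} (B : L2 V →L[ℂ] L2 V) (z : ℂ) : L2 V →L[ℂ] L2 V :=
  Ring.inverse (z • (1 : L2 V →L[ℂ] L2 V) - B)

/-- The resolvent at a real point. -/
def ResR {V : Type} (B : L2 V →L[ℂ] L2 V) (l : ℝ) : L2 V →L[ℂ] L2 V :=
  Res B (l : ℂ)

/-- `G` is the homogeneous Cayley tree of degree `Q`: connected, acyclic,
and every vertex has exactly `Q` neighbours. -/
structure IsCayleyTree {V : Type} (G : SimpleGraph V) (Q : ℕ) : Prop where
  conn : G.Connected
  acyc : G.IsAcyclic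
  deg : ∀ v : V, (G.neighborSet v).ncard = Q

/-- `A` is the adjacency operator of the simple graph `G` on ℓ²(V). -/
def IsAdjacencyOp {V : Type} (G : SimpleGraph V) (A : L2 V →L[ℂ] L2 V) : Prop :=
  ∀ x y : V, entry A x y = if G.Adj x y then 1 else 0

/-- `P` assigns to each subset `S ⊆ V` the orthogonal projection of ℓ²(V) onto ℓ²(S). -/
def IsProjFamily {V : Type} (P : Set V → (L2 V →L[ℂ] L2 V)) : Prop :=
  ∀ (S : Set V) (f : L2 V) (x : V),
    (P S f : ∀ _ : V, ℂ) x = if x ∈ S then (f : ∀ _ : V, ℂ) x else 0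

/-- `S` is the vertex set of a connected subtree of `G` in which every vertex has
exactly `q` neighbours within `S` (a subtree of constant internal degree `q`). -/
def IsRegularSubtree {V : Type} (G : SimpleGraph V) (S : Set V) (q : ℕ) : Prop :=
  (G.induce S).Connected ∧ ∀ x ∈ S, {y : V | y ∈ S ∧ G.Adj x y}.ncard = q

/-- Distance from a vertex to a set of vertices. -/
def distToSet {V : Type} (G : SimpleGraph V) (x : V) (S : Set V) : ℕ :=
  sInf {n : ℕ | ∃ y ∈ S, G.dist x y = n}

/-- `a(λ)` of equation (4.2) of the paper, for the tree of degree `Q`. -/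
def aF (Q : ℕ) (l : ℝ) : ℝ :=
  l * (1 - Real.sqrt (1 - 4 * ((Q : ℝ) - 1) / l ^ 2)) / (2 * ((Q : ℝ) - 1))

/-- `μ(λ)` of equation (4.3) of the paper, for the tree of degree `Q`. -/
def muF (Q : ℕ) (l : ℝ) : ℝ :=
  l * (((Q : ℝ) - 2) + (Q : ℝ) * Real.sqrt (1 - 4 * ((Q : ℝ) - 1) / l ^ 2)) /
    (2 * ((Q : ℝ) - 1))

/-- `M` realizes the inverse, within the corner algebra `P·B(ℓ²)·P`, of the operator
`P − P T P` (that is, of `I_{ℓ²(S)} − S(λ)` when `T` is the resolvent and `P = P_{ℓ²(S)}`). -/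
def IsCornerInverse {V : Type} (P M T : L2 V →L[ℂ] L2 V) : Prop :=
  P ∘L M = M ∧ M ∘L P = M ∧
    M ∘L (P - P ∘L T ∘L P) = P ∧ (P - P ∘L T ∘L P) ∘L M = P

section TreeGeometry

variable {V : Type} {G : SimpleGraph V}

/-- In a tree, a vertex has at most one neighbour closer to a given root. -/
lemma SimpleGraph.IsTree.eq_of_adj_of_dist_add_one (hT : G.IsTree) {u x y z : V}
    (hy : G.Adj y x) (hz : G.Adj z x) (hdy : G.dist u x = G.dist u y + 1)
    (hdz : G.dist u x = G.dist u z + 1) : y = z := by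
  obtain ⟨p, hp⟩ := hT.connected.exists_walk_length_eq_dist u y
  obtain ⟨q, hq⟩ := hT.connected.exists_walk_length_eq_dist u z
  have hp' : (p.concat hy).IsPath :=
    SimpleGraph.Walk.isPath_of_length_eq_dist _ (by rw [SimpleGraph.Walk.length_concat]; omega)
  have hq' : (q.concat hz).IsPath :=
    SimpleGraph.Walk.isPath_of_length_eq_dist _ (by rw [SimpleGraph.Walk.length_concat]; omega)
  have h := congrArg SimpleGraph.Walk.penultimate ((hT.existsUnique_path u x).unique hp' hq')
  simpa using h

lemma SimpleGraph.Connected.exists_adj_dist_add_one (hG : G.Connected) {u x : V} (h : u ≠ x) :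
    ∃ y, G.Adj y x ∧ G.dist u x = G.dist u y + 1 := by
  obtain ⟨p, hp⟩ := hG.exists_walk_length_eq_dist u x
  have hnil : ¬ p.Nil := fun hn => h hn.eq
  refine ⟨p.penultimate, p.adj_penultimate hnil, ?_⟩
  have h1 := G.dist_le p.dropLast
  have h2 := p.length_dropLast_add_one hnil
  have h3 := (p.adj_penultimate hnil).diff_dist_adj (u := u)
  omega

variable {ray : ℕ → V} {nea : V → ℕ}

lemma distToSet_le_dist (x : V) (k : ℕ) : distToSet G x (Set.range ray) ≤ G.dist x (ray k) :=
  Nat.sInf_le ⟨ray k, ⟨k, rfl⟩, rfl⟩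

/-- Distances from a vertex to the points of a geodesic ray in a tree. -/
lemma dist_ray_eq (hT : G.IsTree) (hinj : Function.Injective ray)
    (hadj : ∀ k : ℕ, G.Adj (ray k) (ray (k + 1)))
    (hnea : ∀ x : V, G.dist x (ray (nea x)) = distToSet G x (Set.range ray)) (x : V) (k : ℕ) :
    G.dist x (ray k) = distToSet G x (Set.range ray) + ((k - nea x) + (nea x - k)) := by
  have step : ∀ k, G.dist x (ray k) = G.dist x (ray (k + 1)) + 1 ∨
      G.dist x (ray (k + 1)) = G.dist x (ray k) + 1 := fun k =>
    hT.dist_eq_dist_add_one_of_adj x (hadj k)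
  have peak : ∀ k, ¬ (G.dist x (ray (k + 1)) = G.dist x (ray k) + 1 ∧
      G.dist x (ray (k + 1)) = G.dist x (ray (k + 1 + 1)) + 1) := fun k ⟨h1, h2⟩ => by
    have := hinj (hT.eq_of_adj_of_dist_add_one (hadj k) (hadj (k + 1)).symm h1 h2)
    omega
  have hmin := distToSet_le_dist (G := G) (ray := ray) x
  have hm := hnea x
  have up : ∀ i, G.dist x (ray (nea x + i)) = distToSet G x (Set.range ray) + i ∧
      G.dist x (ray (nea x + i + 1)) = distToSet G x (Set.range ray) + i + 1 := by
    intro i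
    induction i with
    | zero =>
      have h1 := step (nea x)
      have h2 := hmin (nea x + 1)
      simp only [add_zero]
      omega
    | succ i ih =>
      have h1 := step (nea x + i + 1)
      have h2 := peak (nea x + i)
      rw [show nea x + (i + 1) = nea x + i + 1 by omega]
      omega
  have down : ∀ i, i + 1 ≤ nea x → G.dist x (ray (nea x - i)) =
      distToSet G x (Set.range ray) + i ∧
      G.dist x (ray (nea x - (i + 1))) = distToSet G x (Set.range ray) + i + 1 := by
    intro i
    induction i with
    | zero =>
      intro hi
      have h1 := step (nea x - 1)
      have h2 := hmin (nea x - 1)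
      rw [Nat.sub_add_cancel hi] at h1
      simp only [zero_add, tsub_zero]
      omega
    | succ i ih =>
      intro hi
      have h1 := step (nea x - (i + 1 + 1))
      have h2 := peak (nea x - (i + 1 + 1))
      have h3 := ih (by omega)
      rw [show nea x - (i + 1 + 1) + 1 + 1 = nea x - i by omega,
        show nea x - (i + 1 + 1) + 1 = nea x - (i + 1) by omega] at h2
      rw [show nea x - (i + 1 + 1) + 1 = nea x - (i + 1) by omega] at h1
      omega
  rcases le_or_gt (nea x) k with hk | hk
  · have h := (up (k - nea x)).1
    rw [Nat.add_sub_cancel' hk] at h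
    omega
  · have h := (down (nea x - k - 1) (by omega)).2
    rw [show nea x - (nea x - k - 1 + 1) = k by omega] at h
    omega

lemma distToSet_ray (k : ℕ) : distToSet G (ray k) (Set.range ray) = 0 := by
  have := distToSet_le_dist (G := G) (ray := ray) (ray k) k
  simpa using this

lemma eq_ray_of_distToSet_eq_zero (hT : G.IsTree)
    (hnea : ∀ x : V, G.dist x (ray (nea x)) = distToSet G x (Set.range ray)) {x : V}
    (hx : distToSet G x (Set.range ray) = 0) :
    x = ray (nea x) := by
  have := hnea x
  rw [hx] at this
  exact hT.connected.dist_eq_zero_iff.mp this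

section

variable (hT : G.IsTree) (hinj : Function.Injective ray)
  (hadj : ∀ k : ℕ, G.Adj (ray k) (ray (k + 1)))
  (hnea : ∀ x : V, G.dist x (ray (nea x)) = distToSet G x (Set.range ray))

include hT hinj hadj hnea

lemma nea_ray (k : ℕ) : nea (ray k) = k := by
  have := dist_ray_eq hT hinj hadj hnea (ray k) k
  rw [SimpleGraph.dist_self] at this
  omega

private lemma nea_ne_succ_of_adj {x y : V} (h : G.Adj x y)
    (hx : distToSet G x (Set.range ray) = distToSet G y (Set.range ray))
    (hpos : distToSet G x (Set.range ray) ≠ 0) : nea y ≠ nea x + 1 := by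
  intro hs
  have e1 := dist_ray_eq hT hinj hadj hnea x (nea x)
  have e2 := dist_ray_eq hT hinj hadj hnea y (nea x)
  have e3 := dist_ray_eq hT hinj hadj hnea y (nea y)
  have e4 := dist_ray_eq hT hinj hadj hnea x (nea y)
  have hne : ray (nea y) ≠ y := by
    intro he
    rw [he, SimpleGraph.dist_self] at e3
    omega
  obtain ⟨z, hz, hdz⟩ := hT.connected.exists_adj_dist_add_one hne
  have e5 := dist_ray_eq hT hinj hadj hnea z (nea x)
  have e6 := dist_ray_eq hT hinj hadj hnea z (nea y)
  have e7 := hT.dist_eq_dist_add_one_of_adj (ray (nea x)) hz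
  rw [SimpleGraph.dist_comm] at e1 e2 e3 e4 e5 e6
  have hzx : z = x := hT.eq_of_adj_of_dist_add_one (u := ray (nea x)) hz h
    (by omega) (by omega)
  rw [hzx] at hdz
  omega

/-- Adjacent vertices either have the same projection on the ray, or both lie on the ray. -/
lemma nea_eq_or_of_adj {x y : V} (h : G.Adj x y) :
    (nea y = nea x ∧ (distToSet G y (Set.range ray) = distToSet G x (Set.range ray) + 1 ∨
      distToSet G x (Set.range ray) = distToSet G y (Set.range ray) + 1)) ∨
    (distToSet G x (Set.range ray) = 0 ∧ distToSet G y (Set.range ray) = 0 ∧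
      (nea y = nea x + 1 ∨ nea x = nea y + 1)) := by
  have e1 := dist_ray_eq hT hinj hadj hnea x (nea x)
  have e2 := dist_ray_eq hT hinj hadj hnea y (nea x)
  have e3 := dist_ray_eq hT hinj hadj hnea y (nea y)
  have e4 := dist_ray_eq hT hinj hadj hnea x (nea y)
  have s1 := hT.dist_eq_dist_add_one_of_adj (ray (nea x)) h
  have s2 := hT.dist_eq_dist_add_one_of_adj (ray (nea y)) h
  rw [SimpleGraph.dist_comm] at e1 e2 e3 e4
  have n1 := nea_ne_succ_of_adj hT hinj hadj hnea h
  have n2 := nea_ne_succ_of_adj hT hinj hadj hnea h.symm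
  omega

/-- Off the ray, exactly one neighbour is closer to the ray. -/
lemma exists_parent {x : V} (hx : distToSet G x (Set.range ray) ≠ 0) :
    ∃ p, G.Adj x p ∧ nea p = nea x ∧
      distToSet G x (Set.range ray) = distToSet G p (Set.range ray) + 1 ∧
      ∀ y, G.Adj x y → y ≠ p → nea y = nea x ∧
        distToSet G y (Set.range ray) = distToSet G x (Set.range ray) + 1 := by
  have e1 := hnea x
  have hne : ray (nea x) ≠ x := by
    intro he
    rw [he, SimpleGraph.dist_self] at e1
    omega
  obtain ⟨p, hp, hdp⟩ := hT.connected.exists_adj_dist_add_one hne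
  have hpar := nea_eq_or_of_adj hT hinj hadj hnea hp.symm
  have e2 := dist_ray_eq hT hinj hadj hnea p (nea x)
  rw [SimpleGraph.dist_comm] at e1 e2
  refine ⟨p, hp.symm, by omega, by omega, fun y hy hyp => ?_⟩
  have hch := nea_eq_or_of_adj hT hinj hadj hnea hy
  refine ⟨by omega, ?_⟩
  by_contra hcon
  have e3 := dist_ray_eq hT hinj hadj hnea y (nea x)
  rw [SimpleGraph.dist_comm] at e3
  exact hyp (hT.eq_of_adj_of_dist_add_one (u := ray (nea x)) hy.symm hp (by omega) hdp)

/-- The neighbours of a point of the ray. -/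
lemma adj_ray_cases {k : ℕ} {y : V} (h : G.Adj (ray k) y) :
    (nea y = k ∧ distToSet G y (Set.range ray) = 1) ∨ y = ray (k + 1) ∨
      (k ≠ 0 ∧ y = ray (k - 1)) := by
  have h0 := distToSet_ray (G := G) (ray := ray) k
  have h1 := nea_ray hT hinj hadj hnea k
  rcases nea_eq_or_of_adj hT hinj hadj hnea h with h2 | ⟨-, h2, h3⟩
  · left; omega
  · have h4 := eq_ray_of_distToSet_eq_zero hT hnea h2
    rcases h3 with h3 | h3
    · right; left; rw [h4, h3, h1]
    · right; right; exact ⟨by omega, by rw [h4]; congr 1; omega⟩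

end

end TreeGeometry

section TreeSums

variable {V : Type} {G : SimpleGraph V} {ray : ℕ → V} {nea : V → ℕ} {nb : V → Finset V} {Q : ℕ}

section

variable (hT : G.IsTree) (hinj : Function.Injective ray)
  (hadj : ∀ k : ℕ, G.Adj (ray k) (ray (k + 1)))
  (hnea : ∀ x : V, G.dist x (ray (nea x)) = distToSet G x (Set.range ray))
  (hnb : ∀ x y, y ∈ nb x ↔ G.Adj x y) (hcard : ∀ x, (nb x).card = Q)

include hT hinj hadj hnea hnb hcard

lemma sum_nbr_of_notMem_ray (F : ℕ → ℕ → ℝ) {x : V} {D : ℕ}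
    (hx : distToSet G x (Set.range ray) = D + 1) :
    ∑ y ∈ nb x, F (distToSet G y (Set.range ray)) (nea y) =
      F D (nea x) + ((Q : ℝ) - 1) * F (D + 2) (nea x) := by
  obtain ⟨p, hp, hpn, hpd, hch⟩ := exists_parent hT hinj hadj hnea (x := x) (by omega)
  have hpm : p ∈ nb x := (hnb x p).2 hp
  rw [← Finset.add_sum_erase _ _ hpm, hpn, show distToSet G p (Set.range ray) = D by omega]
  congr 1
  rw [Finset.sum_congr rfl (g := fun _ => F (D + 2) (nea x)), Finset.sum_const,
    Finset.card_erase_of_mem hpm, hcard, nsmul_eq_mul, Nat.cast_sub, Nat.cast_one]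
  · rw [← hcard x]; exact Finset.card_pos.2 ⟨p, hpm⟩
  · intro y hy
    obtain ⟨hyp, hy⟩ := Finset.mem_erase.1 hy
    obtain ⟨h1, h2⟩ := hch y ((hnb x y).1 hy) hyp
    rw [h1, h2, hx]

lemma sum_nbr_ray_zero (F : ℕ → ℕ → ℝ) :
    ∑ y ∈ nb (ray 0), F (distToSet G y (Set.range ray)) (nea y) =
      F 0 1 + ((Q : ℝ) - 1) * F 1 0 := by
  have hpm : ray 1 ∈ nb (ray 0) := (hnb _ _).2 (hadj 0)
  rw [← Finset.add_sum_erase _ _ hpm, nea_ray hT hinj hadj hnea, distToSet_ray]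
  congr 1
  rw [Finset.sum_congr rfl (g := fun _ => F 1 0), Finset.sum_const,
    Finset.card_erase_of_mem hpm, hcard, nsmul_eq_mul, Nat.cast_sub, Nat.cast_one]
  · rw [← hcard (ray 0)]; exact Finset.card_pos.2 ⟨_, hpm⟩
  · intro y hy
    obtain ⟨hyp, hy⟩ := Finset.mem_erase.1 hy
    rcases adj_ray_cases hT hinj hadj hnea ((hnb _ y).1 hy) with ⟨h1, h2⟩ | h | ⟨h, -⟩
    · rw [h1, h2]
    · exact absurd h hyp
    · exact absurd rfl h

lemma sum_nbr_ray_succ (F : ℕ → ℕ → ℝ) (k : ℕ) :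
    ∑ y ∈ nb (ray (k + 1)), F (distToSet G y (Set.range ray)) (nea y) =
      F 0 k + F 0 (k + 2) + ((Q : ℝ) - 2) * F 1 (k + 1) := by
  have hpm : ray k ∈ nb (ray (k + 1)) := (hnb _ _).2 (hadj k).symm
  have hpm' : ray (k + 2) ∈ (nb (ray (k + 1))).erase (ray k) :=
    Finset.mem_erase.2 ⟨fun h => by have := hinj h; omega, (hnb _ _).2 (hadj (k + 1))⟩
  have hc : ((nb (ray (k + 1))).erase (ray k)).card = Q - 1 := by
    rw [Finset.card_erase_of_mem hpm, hcard]
  have hc' : 0 < ((nb (ray (k + 1))).erase (ray k)).card := Finset.card_pos.2 ⟨_, hpm'⟩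
  rw [← Finset.add_sum_erase _ _ hpm, ← Finset.add_sum_erase _ _ hpm',
    nea_ray hT hinj hadj hnea, nea_ray hT hinj hadj hnea, distToSet_ray, distToSet_ray, ← add_assoc]
  congr 1
  rw [Finset.sum_congr rfl (g := fun _ => F 1 (k + 1)), Finset.sum_const,
    Finset.card_erase_of_mem hpm', hc, nsmul_eq_mul, Nat.sub_sub, Nat.cast_sub]
  · norm_num
  · omega
  · intro y hy
    obtain ⟨hyp', hy⟩ := Finset.mem_erase.1 hy
    obtain ⟨hyp, hy⟩ := Finset.mem_erase.1 hy
    rcases adj_ray_cases hT hinj hadj hnea ((hnb _ y).1 hy) with ⟨h1, h2⟩ | h | ⟨-, h⟩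
    · rw [h1, h2]
    · exact absurd h hyp'
    · exact absurd h hyp

lemma card_children_le (x : V) :
    ((nb x).filter fun y => distToSet G y (Set.range ray) =
      distToSet G x (Set.range ray) + 1).card ≤ Q - 1 := by
  have hex : ∃ p ∈ nb x, distToSet G p (Set.range ray) ≠ distToSet G x (Set.range ray) + 1 := by
    by_cases hx : distToSet G x (Set.range ray) = 0
    · refine ⟨ray (nea x + 1), (hnb _ _).2 ?_, by rw [distToSet_ray]; omega⟩
      have := hadj (nea x)
      rwa [← eq_ray_of_distToSet_eq_zero hT hnea hx] at this
    · obtain ⟨p, hp, -, hpd, -⟩ := exists_parent hT hinj hadj hnea hx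
      exact ⟨p, (hnb _ _).2 hp, by omega⟩
  obtain ⟨p, hp, hpd⟩ := hex
  rw [← hcard x, ← Finset.card_erase_of_mem hp]
  refine Finset.card_le_card fun y hy => ?_
  obtain ⟨h1, h2⟩ := Finset.mem_filter.1 hy
  exact Finset.mem_erase.2 ⟨fun h => hpd (h ▸ h2), h1⟩

/-- The branch attached to a point of the ray has at most `(Q - 1) ^ D` vertices at height `D`. -/
lemma exists_finset_level (k D : ℕ) : ∃ S : Finset V, S.card ≤ (Q - 1) ^ D ∧
    ∀ x, nea x = k → distToSet G x (Set.range ray) = D → x ∈ S := by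
  suffices h : ∃ S : Finset V, S.card ≤ (Q - 1) ^ D ∧
      ∀ x, x ∈ S ↔ nea x = k ∧ distToSet G x (Set.range ray) = D by
    obtain ⟨S, h1, h2⟩ := h
    exact ⟨S, h1, fun x hx hd => (h2 x).2 ⟨hx, hd⟩⟩
  induction D with
  | zero =>
    refine ⟨{ray k}, by simp, fun x => ?_⟩
    rw [Finset.mem_singleton]
    constructor
    · rintro rfl
      exact ⟨nea_ray hT hinj hadj hnea k, distToSet_ray k⟩
    · rintro ⟨rfl, h⟩
      exact eq_ray_of_distToSet_eq_zero hT hnea h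
  | succ D ih =>
    obtain ⟨S, hS, hm⟩ := ih
    refine ⟨S.biUnion fun x => (nb x).filter fun y => distToSet G y (Set.range ray) =
      distToSet G x (Set.range ray) + 1, ?_, fun y => ?_⟩
    · refine (Finset.card_biUnion_le_card_mul _ _ (Q - 1) fun x _ =>
        card_children_le hT hinj hadj hnea hnb hcard x).trans ?_
      rw [pow_succ]
      exact Nat.mul_le_mul_right _ hS
    · simp only [Finset.mem_biUnion, Finset.mem_filter, hnb]
      constructor
      · rintro ⟨x, hx, hxy, hd⟩
        have h1 := (hm x).1 hx
        have h2 := nea_eq_or_of_adj hT hinj hadj hnea hxy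
        omega
      · rintro ⟨h1, h2⟩
        obtain ⟨p, hp, hpn, hpd, -⟩ := exists_parent hT hinj hadj hnea (x := y) (by omega)
        exact ⟨p, (hm p).2 ⟨by omega, by omega⟩, hp.symm, hpd⟩

/-- Geometric weights of ratio less than `1 / (Q - 1)` are summable along a branch. -/
lemma sum_branch_le {c : ℝ} (hc : 0 ≤ c) (hQ : 1 ≤ Q) (hc1 : ((Q : ℝ) - 1) * c < 1) (k : ℕ)
    (s : Finset V) (hs : ∀ x ∈ s, nea x = k) :
    ∑ x ∈ s, c ^ distToSet G x (Set.range ray) ≤ (1 - ((Q : ℝ) - 1) * c)⁻¹ := by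
  have hQ' : (0 : ℝ) ≤ (Q : ℝ) - 1 := by
    have : (1 : ℝ) ≤ Q := by exact_mod_cast hQ
    linarith
  set t := s.image fun x => distToSet G x (Set.range ray) with ht
  have hmaps : ∀ x ∈ s, distToSet G x (Set.range ray) ∈ t := fun x hx =>
    Finset.mem_image_of_mem _ hx
  rw [← Finset.sum_fiberwise_of_maps_to hmaps]
  calc ∑ D ∈ t, ∑ x ∈ s with distToSet G x (Set.range ray) = D,
        c ^ distToSet G x (Set.range ray)
      ≤ ∑ D ∈ t, (((Q : ℝ) - 1) * c) ^ D := by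
        refine Finset.sum_le_sum fun D _ => ?_
        obtain ⟨S, hS, hm⟩ := exists_finset_level hT hinj hadj hnea hnb hcard k D
        have hle : ((s.filter fun x => distToSet G x (Set.range ray) = D).card : ℝ) ≤
            ((Q : ℝ) - 1) ^ D := by
          have h1 : (s.filter fun x => distToSet G x (Set.range ray) = D).card ≤ (Q - 1) ^ D := by
            refine (Finset.card_le_card fun x hx => ?_).trans hS
            obtain ⟨h1, h2⟩ := Finset.mem_filter.1 hx
            exact hm x (hs x h1) h2
          calc ((s.filter fun x => distToSet G x (Set.range ray) = D).card : ℝ)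
              ≤ (((Q - 1) ^ D : ℕ) : ℝ) := by exact_mod_cast h1
            _ = ((Q : ℝ) - 1) ^ D := by rw [Nat.cast_pow, Nat.cast_sub hQ, Nat.cast_one]
        rw [Finset.sum_congr rfl (g := fun _ => c ^ D) fun x hx => by
          rw [(Finset.mem_filter.1 hx).2], Finset.sum_const, nsmul_eq_mul, mul_pow]
        exact mul_le_mul_of_nonneg_right hle (by positivity)
    _ ≤ ∑' D : ℕ, (((Q : ℝ) - 1) * c) ^ D :=
        (summable_geometric_of_lt_one (by positivity) hc1).sum_le_tsum _
          fun D _ => by positivity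
    _ = (1 - ((Q : ℝ) - 1) * c)⁻¹ := tsum_geometric_of_lt_one (by positivity) hc1

/-- Radial profiles with finite support along the ray and geometric decay off it lie in `ℓ²`. -/
lemma memℓp_ray_profile {a : ℝ} (hQ : 1 ≤ Q) (ha1 : ((Q : ℝ) - 1) * a ^ 2 < 1) (M : ℕ) :
    Memℓp (fun x : V => ((a ^ distToSet G x (Set.range ray) *
      (if nea x ≤ M then 1 else 0) : ℝ) : ℂ)) 2 := by
  refine memℓp_gen' (C := ∑ k ∈ Finset.range (M + 1), (1 - ((Q : ℝ) - 1) * a ^ 2)⁻¹) fun s => ?_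
  have hterm : ∀ x, ‖((a ^ distToSet G x (Set.range ray) *
      (if nea x ≤ M then 1 else 0) : ℝ) : ℂ)‖ ^ (2 : ℝ≥0∞).toReal =
      if nea x ≤ M then (a ^ 2) ^ distToSet G x (Set.range ray) else 0 := fun x => by
    rw [Complex.norm_real]
    split_ifs
    · rw [mul_one, ENNReal.toReal_ofNat, Real.rpow_ofNat, norm_pow, Real.norm_eq_abs, ← pow_mul,
        mul_comm, pow_mul, sq_abs]
    · simp
  rw [Finset.sum_congr rfl fun x _ => hterm x, ← Finset.sum_filter,
    ← Finset.sum_fiberwise_of_maps_to (t := Finset.range (M + 1)) (g := nea)]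
  · refine Finset.sum_le_sum fun k _ => ?_
    exact sum_branch_le hT hinj hadj hnea hnb hcard (sq_nonneg a) hQ ha1 k _
      fun x hx => (Finset.mem_filter.1 hx).2
  · intro x hx
    have := (Finset.mem_filter.1 hx).2
    exact Finset.mem_range.2 (by omega)

end

end TreeSums

section Operators

variable {V : Type}

lemma inner_delta (x : V) (f : L2 V) : inner ℂ (delta x) f = f x := by
  simp [delta, lp.inner_single_left]

lemma delta_apply (x y : V) : (delta x : L2 V) y = if x = y then 1 else 0 := by
  simp [delta, lp.single_apply, Pi.single_apply, eq_comm]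

lemma norm_delta (x : V) : ‖(delta x : L2 V)‖ = 1 := by
  simp only [delta]
  rw [lp.norm_single (by norm_num)]
  simp

lemma IsAdjacencyOp.apply_eq_sum {G : SimpleGraph V} {A : L2 V →L[ℂ] L2 V}
    (hA : IsAdjacencyOp G A) (hsa : IsSelfAdjoint A) {nb : V → Finset V}
    (hnb : ∀ x y, y ∈ nb x ↔ G.Adj x y) (f : L2 V) (x : V) : A f x = ∑ y ∈ nb x, f y := by
  have hcol : A (delta x) = ∑ y ∈ nb x, delta y := by
    apply lp.ext
    funext z
    rw [lp.coeFn_sum, Finset.sum_apply]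
    simp only [delta_apply, Finset.sum_ite_eq', hnb]
    rw [G.adj_comm]
    exact hA z x
  have hs : inner ℂ (A (delta x)) f = inner ℂ (delta x) (A f) := hsa.isSymmetric (delta x) f
  rw [← inner_delta x, ← hs, hcol, sum_inner]
  simp only [inner_delta]

/-- **Schur test** for a symmetric matrix with entries `0` and `1` and a positive eigenfunction. -/
lemma norm_le_of_pos_eigenfunction {nb : V → Finset V} (hsymm : ∀ x y, y ∈ nb x ↔ x ∈ nb y)
    {v : V → ℝ} (hv : ∀ x, 0 < v x) {l : ℝ} (hl : 0 ≤ l) (heig : ∀ x, ∑ y ∈ nb x, v y = l * v x)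
    (B : L2 V →L[ℂ] L2 V) (hB : ∀ f x, B f x = ∑ y ∈ nb x, f y) : ‖B‖ ≤ l := by
  refine B.opNorm_le_bound hl fun f => ?_
  refine lp.norm_le_of_forall_sum_le (by norm_num) (by positivity) fun s => ?_
  have h2 : (2 : ℝ≥0∞).toReal = ((2 : ℕ) : ℝ) := by norm_num
  simp only [h2, Real.rpow_natCast]
  have hrow : ∀ x, ‖B f x‖ ^ 2 ≤ l * v x * ∑ y ∈ nb x, ‖f y‖ ^ 2 / v y := fun x => by
    rw [hB, ← heig]
    refine (pow_le_pow_left₀ (norm_nonneg _) (norm_sum_le _ _) 2).trans ?_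
    refine Finset.sum_sq_le_sum_mul_sum_of_sq_le_mul _ (fun y _ => (hv y).le)
      (fun y _ => div_nonneg (sq_nonneg _) (hv y).le) fun y _ => le_of_eq ?_
    have := (hv y).ne'
    field_simp
  calc ∑ x ∈ s, ‖B f x‖ ^ 2
      ≤ ∑ x ∈ s, ∑ y ∈ nb x, l * v x * (‖f y‖ ^ 2 / v y) := by
        refine Finset.sum_le_sum fun x _ => (hrow x).trans_eq ?_
        rw [Finset.mul_sum]
    _ = ∑ y ∈ s.biUnion nb, ∑ x ∈ s with y ∈ nb x, l * v x * (‖f y‖ ^ 2 / v y) := by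
        refine Finset.sum_comm' fun x y => ?_
        simp only [Finset.mem_biUnion, Finset.mem_filter]
        constructor
        · rintro ⟨h1, h2⟩
          exact ⟨⟨h1, h2⟩, x, h1, h2⟩
        · rintro ⟨h1, -⟩
          exact h1
    _ ≤ ∑ y ∈ s.biUnion nb, l ^ 2 * ‖f y‖ ^ 2 := by
        refine Finset.sum_le_sum fun y _ => ?_
        rw [← Finset.sum_mul, ← Finset.mul_sum]
        have hle : ∑ x ∈ s with y ∈ nb x, v x ≤ l * v y := by
          rw [← heig]
          refine Finset.sum_le_sum_of_subset_of_nonneg (fun x hx => ?_) fun x _ _ => (hv x).le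
          exact (hsymm x y).1 (Finset.mem_filter.1 hx).2
        calc l * (∑ x ∈ s with y ∈ nb x, v x) * (‖f y‖ ^ 2 / v y)
            ≤ l * (l * v y) * (‖f y‖ ^ 2 / v y) := by
              have := (hv y).le
              gcongr
          _ = l ^ 2 * ‖f y‖ ^ 2 := by
              have := (hv y).ne'
              field_simp
    _ ≤ (l * ‖f‖) ^ 2 := by
        rw [← Finset.mul_sum, mul_pow]
        have h := lp.sum_rpow_le_norm_rpow (by norm_num) f (s.biUnion nb)
        simp only [h2, Real.rpow_natCast] at h
        gcongr

/-- If `B - l` is uniformly bounded on vectors of arbitrarily large norm, then `l ≤ ‖B‖`. -/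
lemma le_norm_of_approx_eigenvectors {E : Type*} [NormedAddCommGroup E] [NormedSpace ℂ E]
    (B : E →L[ℂ] E) {l C : ℝ} (f : ℕ → E) (hf : ∀ M : ℕ, (M : ℝ) ≤ ‖f M‖ ^ 2)
    (hB : ∀ M, ‖B (f M) - (l : ℂ) • f M‖ ≤ C) : l ≤ ‖B‖ := by
  by_contra! hlt
  have key : ∀ M, (l - ‖B‖) * ‖f M‖ ≤ C := fun M => by
    have h1 : ‖(l : ℂ) • f M‖ = l * ‖f M‖ := by
      rw [norm_smul, Complex.norm_real, Real.norm_of_nonneg ((norm_nonneg B).trans hlt.le)]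
    have h2 := norm_sub_norm_le ((l : ℂ) • f M) (B (f M))
    rw [norm_sub_rev, h1] at h2
    linarith [hB M, B.le_opNorm (f M)]
  have hpos : 0 < l - ‖B‖ := sub_pos.2 hlt
  obtain ⟨M, hM⟩ := exists_nat_gt ((C / (l - ‖B‖)) ^ 2)
  have h1 : ‖f M‖ ≤ C / (l - ‖B‖) := by
    rw [le_div_iff₀ hpos]
    linarith [key M]
  have h2 := pow_le_pow_left₀ (norm_nonneg _) h1 2
  linarith [hf M]

end Operators

section RayProfile

variable {V : Type} {G : SimpleGraph V} {ray : ℕ → V} {nea : V → ℕ} {nb : V → Finset V} {Q : ℕ}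
  (hT : G.IsTree) (hinj : Function.Injective ray)
  (hadj : ∀ k : ℕ, G.Adj (ray k) (ray (k + 1)))
  (hnea : ∀ x : V, G.dist x (ray (nea x)) = distToSet G x (Set.range ray))
  (hnb : ∀ x y, y ∈ nb x ↔ G.Adj x y) (hcard : ∀ x, (nb x).card = Q)

include hT hinj hadj hnea hnb hcard

/-- The matrix of `ℍ^Q` applied to a function with geometric decay off the ray: the defect from
being an eigenfunction is the discrete Laplacian of the profile along the ray. -/
lemma sum_ray_profile {a l : ℝ} (ha : a ^ 2 = 3 * a - 1) (hl : l = 3 + ((Q : ℝ) - 2) * a)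
    (g : ℕ → ℝ) {w : V → ℝ} (hw : ∀ x, w x = a ^ distToSet G x (Set.range ray) * g (nea x))
    (x : V) :
    ∑ y ∈ nb x, w y + (Set.range ray).indicator w x = l * w x +
      (Set.range ray).indicator (fun x => if nea x = 0 then g 1 + (a - 2) * g 0
        else g (nea x - 1) + g (nea x + 1) - 2 * g (nea x)) x := by
  simp only [hw]
  by_cases hx : x ∈ Set.range ray
  · rw [Set.indicator_of_mem hx, Set.indicator_of_mem hx]
    obtain ⟨k, rfl⟩ := hx
    rw [hw (ray k), nea_ray hT hinj hadj hnea, distToSet_ray]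
    rcases k with _ | k
    · rw [sum_nbr_ray_zero hT hinj hadj hnea hnb hcard (fun d n => a ^ d * g n), hl, if_pos rfl]
      ring
    · rw [sum_nbr_ray_succ hT hinj hadj hnea hnb hcard (fun d n => a ^ d * g n), hl,
        if_neg k.succ_ne_zero, Nat.add_sub_cancel]
      ring
  · rw [Set.indicator_of_notMem hx, Set.indicator_of_notMem hx]
    obtain ⟨D, hD⟩ : ∃ D, distToSet G x (Set.range ray) = D + 1 :=
      Nat.exists_eq_succ_of_ne_zero fun h =>
        hx ⟨_, (eq_ray_of_distToSet_eq_zero hT hnea h).symm⟩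
    rw [sum_nbr_of_notMem_ray hT hinj hadj hnea hnb hcard (fun d n => a ^ d * g n) hD, hD, hl]
    linear_combination a ^ D * g (nea x) * ha

end RayProfile

lemma aF_eq {Q : ℕ} (hQ : 3 ≤ Q) {a l : ℝ} (ha : a ^ 2 = 3 * a - 1)
    (hl : l = 3 + ((Q : ℝ) - 2) * a) (ha0 : 0 < a) (hQa : (Q : ℝ) * a ≤ 3) : aF Q l = a := by
  have hQ' : (3 : ℝ) ≤ Q := by exact_mod_cast hQ
  have hlpos : 0 < l := by rw [hl]; nlinarith
  have hsq : 1 - 4 * ((Q : ℝ) - 1) / l ^ 2 = ((3 - Q * a) / l) ^ 2 := by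
    field_simp
    rw [hl]
    linear_combination (-4 * (Q : ℝ) + 4) * ha
  rw [aF, hsq, Real.sqrt_sq (div_nonneg (by linarith) hlpos.le)]
  have h1 : (Q : ℝ) - 1 ≠ 0 := by linarith
  field_simp
  rw [hl]
  ring

/-- **Theorem 5.2.** For `3 ≤ Q ≤ 7`, let `N = {x_0, x_1, …}` be a one-sided infinite
geodesic ray in `𝔾^Q` and `A_{ℍ^Q} = A + P_{ℓ²(N)}`.  With `λ* = (3−√5)Q/2 + √5` and
`a* = a(λ*)`, the weight `v(x) = (a*)^{d(x,N)}·[n(x)(1 − a*) + 1]`, where `x_{n(x)}` is the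
vertex of `N` closest to `x`, is a generalized Perron–Frobenius eigenvector of `A_{ℍ^Q}`;
in particular `‖A_{ℍ^Q}‖ = λ*`. -/
theorem perron_frobenius_HQ (Q : ℕ) (hQ3 : 3 ≤ Q) (hQ7 : Q ≤ 7)
    {V : Type} (G : SimpleGraph V) (hG : IsCayleyTree G Q)
    (A : L2 V →L[ℂ] L2 V) (hA : IsAdjacencyOp G A) (hsa : IsSelfAdjoint A)
    (P : Set V → (L2 V →L[ℂ] L2 V)) (hP : IsProjFamily P)
    (ray : ℕ → V) (hinj : Function.Injective ray)
    (hadj : ∀ k : ℕ, G.Adj (ray k) (ray (k + 1)))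
    (lamstar : ℝ) (hls : lamstar = (3 - Real.sqrt 5) * (Q : ℝ) / 2 + Real.sqrt 5)
    (astar : ℝ) (hastar : astar = aF Q lamstar)
    (nea : V → ℕ)
    (hnea : ∀ x : V, G.dist x (ray (nea x)) = distToSet G x (Set.range ray))
    (v : V → ℝ)
    (hv : ∀ x : V,
      v x = astar ^ distToSet G x (Set.range ray) * ((nea x : ℝ) * (1 - astar) + 1)) :
    ‖A + P (Set.range ray)‖ = lamstar ∧
    (∀ x : V, 0 < v x) ∧
    (∀ x : V, (∑' y : G.neighborSet x, v (y : V)) + (Set.range ray).indicator v x =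
      lamstar * v x) := by
  obtain ⟨hconn, hacyc, hdeg⟩ := hG
  have hT : G.IsTree := ⟨hconn, hacyc⟩
  have hQ3' : (3 : ℝ) ≤ Q := by exact_mod_cast hQ3
  have hQ7' : (Q : ℝ) ≤ 7 := by exact_mod_cast hQ7
  have hfin : ∀ x, (G.neighborSet x).Finite := fun x =>
    Set.finite_of_ncard_ne_zero (by rw [hdeg]; omega)
  set nb : V → Finset V := fun x => (hfin x).toFinset with hnbdef
  have hnb : ∀ x y, y ∈ nb x ↔ G.Adj x y := fun x y => by simp [hnbdef]
  have hcoe : ∀ x, (nb x : Set V) = G.neighborSet x := fun x => by simp [hnbdef]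
  have hcard : ∀ x, (nb x).card = Q := fun x => by
    rw [← hdeg x, ← hcoe x, Set.ncard_coe_finset]
  have h5 : Real.sqrt 5 ^ 2 = 5 := Real.sq_sqrt (by norm_num)
  have h5l : 20 / 9 < Real.sqrt 5 := Real.lt_sqrt_of_sq_lt (by norm_num)
  have h5u : Real.sqrt 5 < 3 := by
    rw [Real.sqrt_lt' (by norm_num)]; norm_num
  have ha : ((3 - Real.sqrt 5) / 2) ^ 2 = 3 * ((3 - Real.sqrt 5) / 2) - 1 := by
    linear_combination h5 / 4
  have hl : lamstar = 3 + ((Q : ℝ) - 2) * ((3 - Real.sqrt 5) / 2) := by rw [hls]; ring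
  rw [aF_eq hQ3 ha hl (by linarith) (by nlinarith)] at hastar
  rw [← hastar] at ha hl
  have ha0 : 0 < astar := by rw [hastar]; linarith
  have ha1 : astar < 7 / 18 := by rw [hastar]; linarith
  clear hastar hls
  have hlpos : 0 < lamstar := by rw [hl]; nlinarith
  have hvpos : ∀ x, 0 < v x := fun x => by
    rw [hv]
    have : 0 < 1 - astar := by linarith
    positivity
  have heig : ∀ x, ∑ y ∈ nb x, v y + (Set.range ray).indicator v x = lamstar * v x := fun x => by
    rw [sum_ray_profile hT hinj hadj hnea hnb hcard ha hl
      (fun n => (n : ℝ) * (1 - astar) + 1) hv x, add_eq_left]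
    refine Set.indicator_apply_eq_zero.2 fun _ => ?_
    rcases nea x with _ | k
    · norm_num
      ring
    · rw [if_neg k.succ_ne_zero, Nat.add_sub_cancel]
      push_cast
      ring
  have hBapp : ∀ (f : L2 V) (x : V), (A + P (Set.range ray)) f x =
      ∑ y ∈ nb x, f y + (Set.range ray).indicator f x := fun f x => by
    have h1 : (A + P (Set.range ray)) f x = A f x + P (Set.range ray) f x := rfl
    rw [h1, hA.apply_eq_sum hsa hnb, hP, Set.indicator_apply]
  refine ⟨le_antisymm ?_ ?_, hvpos, fun x => ?_⟩
  · have hloop : ∀ {R : Type} [AddCommMonoid R] (h : V → R) (x : V),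
        ∑ y ∈ (if x ∈ Set.range ray then insert x (nb x) else nb x), h y =
          ∑ y ∈ nb x, h y + (Set.range ray).indicator h x := fun h x => by
      rw [Set.indicator_apply]
      split_ifs
      · rw [Finset.sum_insert (by simp [hnb]), add_comm]
      · rw [add_zero]
    refine norm_le_of_pos_eigenfunction
      (nb := fun x => if x ∈ Set.range ray then insert x (nb x) else nb x)
      (fun x y => ?_) hvpos hlpos.le (fun x => ?_) _ fun f x => ?_
    · have := G.adj_comm x y
      by_cases hxy : x = y
      · rw [hxy]
      · have hyx : y ≠ x := fun h => hxy h.symm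
        split_ifs <;> simp [hnb, hxy, hyx, this]
    · rw [hloop, heig]
    · rw [hloop, hBapp]
  · have hsub : ((Q : ℝ) - 1) * astar ^ 2 < 1 := by rw [ha]; nlinarith
    set w : ℕ → V → ℝ := fun M x => astar ^ distToSet G x (Set.range ray) *
      (if nea x ≤ M then 1 else 0) with hw
    set f : ℕ → L2 V := fun M => ⟨fun x => (w M x : ℂ),
      memℓp_ray_profile hT hinj hadj hnea hnb hcard (by omega) hsub M⟩
    have hfapp : ∀ M x, f M x = (w M x : ℂ) := fun M x => rfl
    refine le_norm_of_approx_eigenvectors _ (C := 3) f (fun M => ?_) fun M => ?_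
    · have h := lp.sum_rpow_le_norm_rpow (by norm_num) (f M)
        ((Finset.range M).image ray)
      rw [Finset.sum_image fun i _ j _ hij => hinj hij] at h
      simp only [ENNReal.toReal_ofNat, Real.rpow_ofNat] at h
      refine le_trans (le_of_eq ?_) h
      rw [Finset.sum_congr rfl (g := fun _ => (1 : ℝ))]
      · simp
      · intro k hk
        have hk' := (Finset.mem_range.1 hk).le
        rw [hfapp, hw]
        simp [nea_ray hT hinj hadj hnea, distToSet_ray, hk']
    · have hr : (A + P (Set.range ray)) (f M) - (lamstar : ℂ) • f M =
          ((astar - 1 : ℝ) : ℂ) • delta (ray 0) - delta (ray M) + delta (ray (M + 1)) := by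
        apply lp.ext
        funext x
        have h1 := sum_ray_profile hT hinj hadj hnea hnb hcard ha hl
          (fun n => if n ≤ M then 1 else 0) (w := w M) (fun x => rfl) x
        have h2 : (A + P (Set.range ray)) (f M) x =
            ((∑ y ∈ nb x, w M y + (Set.range ray).indicator (w M) x : ℝ) : ℂ) := by
          rw [hBapp, Set.indicator_apply, Set.indicator_apply]
          simp only [hfapp]
          push_cast
          split_ifs <;> simp
        have h3 : ((A + P (Set.range ray)) (f M) - (lamstar : ℂ) • f M : L2 V) x =
            (A + P (Set.range ray)) (f M) x - (lamstar : ℂ) * f M x := rfl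
        have h4 : (((astar - 1 : ℝ) : ℂ) • delta (ray 0) - delta (ray M) + delta (ray (M + 1)) :
            L2 V) x = ((astar - 1 : ℝ) : ℂ) * (delta (ray 0) : L2 V) x -
              (delta (ray M) : L2 V) x + (delta (ray (M + 1)) : L2 V) x := rfl
        rw [h3, h4, h2, h1, hfapp]
        simp only [delta_apply]
        by_cases hx : x ∈ Set.range ray
        · rw [Set.indicator_of_mem hx]
          obtain ⟨k, rfl⟩ := hx
          rw [nea_ray hT hinj hadj hnea]
          simp only [hinj.eq_iff]
          have hreal : (if k = 0 then (if 1 ≤ M then 1 else 0) +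
              (astar - 2) * (if 0 ≤ M then 1 else 0)
              else (if k - 1 ≤ M then 1 else 0) + (if k + 1 ≤ M then 1 else 0) -
                2 * (if k ≤ M then 1 else 0) : ℝ) =
              (astar - 1) * (if 0 = k then 1 else 0) - (if M = k then 1 else 0) +
                (if M + 1 = k then 1 else 0) := by
            split_ifs <;> first | omega | ring
          rw [hreal]
          split_ifs <;> push_cast <;> ring
        · have hne : ∀ k, ray k ≠ x := fun k hk => hx ⟨k, hk⟩
          rw [Set.indicator_of_notMem hx]
          simp [hne]
      rw [hr]
      refine (norm_add_le _ _).trans ?_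
      have h1 := norm_sub_le (((astar - 1 : ℝ) : ℂ) • delta (ray 0)) (delta (ray M))
      have h2 : |astar - 1| ≤ 1 := abs_le.2 ⟨by linarith, by linarith⟩
      rw [norm_smul, Complex.norm_real, Real.norm_eq_abs, norm_delta, norm_delta] at h1
      rw [norm_delta]
      linarith
  · rw [← heig x, ← Finset.tsum_subtype' (nb x) v, hcoe x]
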